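/- arXiv:math/9712233 — 8 statements merged into one kernel-verified Lean document; each statement's English description precedes it below -/
import Mathlib

section
/- For every even integer m ≥ 2 and every integer n ≥ 1 with gcd(m,n) = 1, the group G(m,n) is isomorphic to the direct product D*₄ₘ × Cₙ of the binary dihedral group of order 4m and the cyclic group of order n. -/
/-- The relator `b⁻¹ a b a`, expressing the relation `b⁻¹ a b = a⁻¹` in the
Klein bottle group (generator `0` is `a`, generator `1` is `b`). -/
abbrev kleinRel : FreeGroup (Fin 2) :=
  (FreeGroup.of 1)⁻¹ * FreeGroup.of 0 * FreeGroup.of 1 * FreeGroup.of 0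

/-- The relator `aᵐ b²ⁿ`. -/
abbrev surgeryRel (m n : ℕ) : FreeGroup (Fin 2) :=
  FreeGroup.of 0 ^ m * FreeGroup.of 1 ^ (2 * n)

/-- The group `G(m,n) = ⟨a, b | b⁻¹ a b = a⁻¹, aᵐ b²ⁿ = 1⟩`,
the fundamental group of `M(m,n)`. -/
abbrev Gmn (m n : ℕ) : Type :=
  PresentedGroup ({kleinRel, surgeryRel m n} : Set (FreeGroup (Fin 2)))

/-- The binary dihedral (dicyclic) group `D*₄ₘ = ⟨x, y | x² = (xy)² = yᵐ⟩`
(generator `0` is `x`, generator `1` is `y`). -/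
abbrev BinaryDihedral (m : ℕ) : Type :=
  PresentedGroup
    ({FreeGroup.of 0 ^ 2 * ((FreeGroup.of 0 * FreeGroup.of 1) ^ 2)⁻¹,
      (FreeGroup.of 0 * FreeGroup.of 1) ^ 2 * (FreeGroup.of 1 ^ m)⁻¹} :
      Set (FreeGroup (Fin 2)))

/-- The generalized dihedral group
`D₍₂ᵏ,ₘ₎ = ⟨x, y | x^(2ᵏ) = yᵐ = 1, x⁻¹ y x = y⁻¹⟩`
(generator `0` is `x`, generator `1` is `y`). -/
abbrev GenDihedral (k m : ℕ) : Type :=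
  PresentedGroup
    ({FreeGroup.of 0 ^ 2 ^ k, FreeGroup.of 1 ^ m,
      (FreeGroup.of 0)⁻¹ * FreeGroup.of 1 * FreeGroup.of 0 * FreeGroup.of 1} :
      Set (FreeGroup (Fin 2)))

section Inversion

variable {H : Type*} [Group H] {a b : H}

theorem SemiconjBy.commute_sq_of_inv (h : SemiconjBy b a a⁻¹) : Commute (b ^ 2) a := by
  have := h.inv_right.mul_left h
  rwa [inv_inv, ← sq] at this

theorem SemiconjBy.mul_mul_eq_of_inv (h : SemiconjBy b a a⁻¹) : a * b * a = b := by
  rw [mul_assoc, h.eq, mul_inv_cancel_left]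

theorem SemiconjBy.pow_sq_eq_one_of_inv (h : SemiconjBy b a a⁻¹) {m : ℕ}
    (hc : Commute b (a ^ m)) : (a ^ m) ^ 2 = 1 := by
  have h₁ : b * a ^ m = (a ^ m)⁻¹ * b := by rw [← inv_pow]; exact h.pow_right m
  have h₂ : a ^ m = (a ^ m)⁻¹ := mul_right_cancel (hc.eq.symm.trans h₁)
  rw [sq]
  exact mul_eq_one_iff_eq_inv.2 h₂

end Inversion

theorem pow_eq_self_of_sq_eq_one {M : Type*} [Monoid M] {z : M} (hz : z ^ 2 = 1) {n : ℕ}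
    (hn : Odd n) : z ^ n = z := by
  obtain ⟨k, rfl⟩ := hn
  rw [pow_succ, pow_mul, hz, one_pow, one_mul]

/-- The homomorphism from the cyclic group of order `n` that sends the generator to `w`. -/
def cyclicLift {H : Type*} [Group H] (n : ℕ) (w : H) (hw : w ^ n = 1) :
    Multiplicative (ZMod n) →* H :=
  AddMonoidHom.toMultiplicativeLeft
    (ZMod.lift n ⟨AddMonoidHom.toMultiplicativeLeft.symm (zpowersHom H w), by
      change Additive.ofMul (w ^ (n : ℤ)) = 0
      rw [zpow_natCast, hw]; rfl⟩)

theorem cyclicLift_ofAdd_intCast {H : Type*} [Group H] (n : ℕ) (w : H) (hw : w ^ n = 1) (k : ℤ) :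
    cyclicLift n w hw (Multiplicative.ofAdd (k : ZMod n)) = w ^ k := by
  change Additive.toMul (ZMod.lift n _ (k : ZMod n)) = w ^ k
  rw [ZMod.lift_coe]
  rfl

theorem ofAdd_one_zpow (n : ℕ) (k : ℤ) :
    (Multiplicative.ofAdd (1 : ZMod n)) ^ k = Multiplicative.ofAdd (k : ZMod n) := by
  rw [← ofAdd_zsmul, zsmul_one]

theorem ofAdd_one_pow_self (n : ℕ) : (Multiplicative.ofAdd (1 : ZMod n)) ^ n = 1 := by
  rw [← ofAdd_nsmul, nsmul_one, ZMod.natCast_self, ofAdd_zero]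

namespace Gmn

/-- The generator `a` of `G(m,n)`. -/
def a (m n : ℕ) : Gmn m n := PresentedGroup.of 0

/-- The generator `b` of `G(m,n)`. -/
def b (m n : ℕ) : Gmn m n := PresentedGroup.of 1

variable {m n : ℕ}

theorem semiconjBy : SemiconjBy (b m n) (a m n) (a m n)⁻¹ := by
  have h : (b m n)⁻¹ * a m n * b m n * a m n = 1 :=
    PresentedGroup.one_of_mem (rels := {kleinRel, surgeryRel m n}) (Set.mem_insert _ _)
  have h' : SemiconjBy (b m n) (a m n)⁻¹ (a m n) := by
    rw [SemiconjBy, ← mul_eq_one_iff_eq_inv.1 h]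
    group
  simpa using h'.inv_right

theorem a_pow_mul_b_pow : a m n ^ m * b m n ^ (2 * n) = 1 :=
  PresentedGroup.one_of_mem (rels := {kleinRel, surgeryRel m n})
    (Set.mem_insert_of_mem _ rfl)

theorem a_pow_eq : a m n ^ m = (b m n ^ (2 * n))⁻¹ := mul_eq_one_iff_eq_inv.1 a_pow_mul_b_pow

theorem a_pow_sq : (a m n ^ m) ^ 2 = 1 := by
  refine semiconjBy.pow_sq_eq_one_of_inv ?_
  rw [a_pow_eq]
  exact (Commute.self_pow _ _).inv_right

theorem b_pow_sq : (b m n ^ (2 * n)) ^ 2 = 1 := by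
  simpa [a_pow_eq] using a_pow_sq (m := m) (n := n)

theorem b_pow_two_mul : b m n ^ (2 * n) = a m n ^ m :=
  (mul_eq_one_iff_eq_inv.1 ((sq _).symm.trans b_pow_sq)).trans a_pow_eq.symm

/-- The homomorphism out of `G(m,n)` determined by the images of the generators. -/
def lift {H : Type*} [Group H] (x y : H) (h₁ : y⁻¹ * x * y * x = 1)
    (h₂ : x ^ m * y ^ (2 * n) = 1) : Gmn m n →* H :=
  PresentedGroup.toGroup (f := ![x, y]) (by
    rintro r (rfl | rfl)
    · simpa using h₁
    · simpa using h₂)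

theorem lift_a {H : Type*} [Group H] (x y : H) (h₁ : y⁻¹ * x * y * x = 1)
    (h₂ : x ^ m * y ^ (2 * n) = 1) : lift x y h₁ h₂ (a m n) = x :=
  PresentedGroup.toGroup.of _

theorem lift_b {H : Type*} [Group H] (x y : H) (h₁ : y⁻¹ * x * y * x = 1)
    (h₂ : x ^ m * y ^ (2 * n) = 1) : lift x y h₁ h₂ (b m n) = y :=
  PresentedGroup.toGroup.of _

theorem hom_ext {H : Type*} [Group H] {f g : Gmn m n →* H} (ha : f (a m n) = g (a m n))
    (hb : f (b m n) = g (b m n)) : f = g := by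
  refine PresentedGroup.ext fun i => ?_
  fin_cases i
  exacts [ha, hb]

end Gmn

namespace BinaryDihedral

/-- The generator `x` of the binary dihedral group. -/
def x (m : ℕ) : BinaryDihedral m := PresentedGroup.of 0

/-- The generator `y` of the binary dihedral group. -/
def y (m : ℕ) : BinaryDihedral m := PresentedGroup.of 1

variable {m : ℕ}

theorem x_sq : x m ^ 2 = (x m * y m) ^ 2 :=
  mul_inv_eq_one.1 (PresentedGroup.one_of_mem (rels :=
    {FreeGroup.of 0 ^ 2 * ((FreeGroup.of 0 * FreeGroup.of 1) ^ 2)⁻¹,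
      (FreeGroup.of 0 * FreeGroup.of 1) ^ 2 * (FreeGroup.of 1 ^ m)⁻¹}) (Set.mem_insert _ _))

theorem xy_sq : (x m * y m) ^ 2 = y m ^ m :=
  mul_inv_eq_one.1 (PresentedGroup.one_of_mem (rels :=
    {FreeGroup.of 0 ^ 2 * ((FreeGroup.of 0 * FreeGroup.of 1) ^ 2)⁻¹,
      (FreeGroup.of 0 * FreeGroup.of 1) ^ 2 * (FreeGroup.of 1 ^ m)⁻¹})
    (Set.mem_insert_of_mem _ rfl))

theorem x_sq_eq_y_pow : x m ^ 2 = y m ^ m := x_sq.trans xy_sq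

theorem semiconjBy : SemiconjBy (x m) (y m) (y m)⁻¹ := by
  have h : x m * x m = x m * (y m * x m * y m) := by
    simpa only [sq, mul_assoc] using x_sq (m := m)
  rw [SemiconjBy, eq_inv_mul_iff_mul_eq, ← mul_assoc]
  exact (mul_left_cancel h).symm

theorem x_sq_sq : (x m ^ 2) ^ 2 = 1 := by
  rw [x_sq_eq_y_pow]
  refine semiconjBy.pow_sq_eq_one_of_inv ?_
  rw [← x_sq_eq_y_pow]
  exact Commute.self_pow _ _

/-- The homomorphism out of the binary dihedral group determined by the images of the
generators. -/
def lift {H : Type*} [Group H] (u v : H) (h₁ : u ^ 2 = (u * v) ^ 2)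
    (h₂ : (u * v) ^ 2 = v ^ m) : BinaryDihedral m →* H :=
  PresentedGroup.toGroup (f := ![u, v]) (by
    rintro r (rfl | rfl)
    · simpa [mul_inv_eq_one] using h₁
    · simpa [mul_inv_eq_one] using h₂)

theorem lift_x {H : Type*} [Group H] (u v : H) (h₁ : u ^ 2 = (u * v) ^ 2)
    (h₂ : (u * v) ^ 2 = v ^ m) : lift u v h₁ h₂ (x m) = u :=
  PresentedGroup.toGroup.of _

theorem lift_y {H : Type*} [Group H] (u v : H) (h₁ : u ^ 2 = (u * v) ^ 2)
    (h₂ : (u * v) ^ 2 = v ^ m) : lift u v h₁ h₂ (y m) = v :=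
  PresentedGroup.toGroup.of _

theorem hom_ext {H : Type*} [Group H] {f g : BinaryDihedral m →* H} (hx : f (x m) = g (x m))
    (hy : f (y m) = g (y m)) : f = g := by
  refine PresentedGroup.ext fun i => ?_
  fin_cases i
  exacts [hx, hy]

end BinaryDihedral

theorem cyclic_hom_ext {H : Type*} [Group H] {n : ℕ} {f g : Multiplicative (ZMod n) →* H}
    (h : f (Multiplicative.ofAdd 1) = g (Multiplicative.ofAdd 1)) : f = g := by
  refine MonoidHom.ext fun c => ?_
  obtain ⟨k, hk⟩ := ZMod.intCast_surjective c.toAdd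
  have hc : c = Multiplicative.ofAdd (1 : ZMod n) ^ k := by
    rw [ofAdd_one_zpow, hk, ofAdd_toAdd]
  rw [hc, map_zpow, map_zpow, h]

theorem cyclicLift_ofAdd_one {H : Type*} [Group H] (n : ℕ) (w : H) (hw : w ^ n = 1) :
    cyclicLift n w hw (Multiplicative.ofAdd 1) = w := by
  simpa using cyclicLift_ofAdd_intCast n w hw 1

namespace Gmn

variable {m n : ℕ}

/-- The homomorphism `a ↦ (y, 1)`, `b ↦ (x, c)`. -/
def toProd (m : ℕ) (hn : Odd n) :
    Gmn m n →* BinaryDihedral m × Multiplicative (ZMod n) :=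
  lift (BinaryDihedral.y m, 1) (BinaryDihedral.x m, Multiplicative.ofAdd 1)
    (by
      refine Prod.ext ?_ (by simp)
      change (BinaryDihedral.x m)⁻¹ * BinaryDihedral.y m * BinaryDihedral.x m
        * BinaryDihedral.y m = 1
      rw [mul_assoc, mul_assoc, ← mul_assoc (BinaryDihedral.y m),
        BinaryDihedral.semiconjBy.mul_mul_eq_of_inv, inv_mul_cancel])
    (by
      refine Prod.ext ?_ ?_
      · change BinaryDihedral.y m ^ m * BinaryDihedral.x m ^ (2 * n) = 1
        rw [pow_mul, pow_eq_self_of_sq_eq_one BinaryDihedral.x_sq_sq hn,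
          ← BinaryDihedral.x_sq_eq_y_pow, ← sq, BinaryDihedral.x_sq_sq]
      · change 1 ^ m * Multiplicative.ofAdd (1 : ZMod n) ^ (2 * n) = 1
        rw [one_pow, one_mul, mul_comm, pow_mul, ofAdd_one_pow_self, one_pow])

theorem commute_b_pow (k : ℕ) : Commute (b m n ^ (2 * k)) (a m n) := by
  rw [pow_mul]
  exact semiconjBy.commute_sq_of_inv.pow_left k

theorem semiconjBy_b_pow {k : ℕ} (hk : Odd k) : SemiconjBy (b m n ^ k) (a m n) (a m n)⁻¹ := by
  obtain ⟨j, rfl⟩ := hk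
  rw [pow_succ]
  exact SemiconjBy.mul_left (commute_b_pow j).inv_right semiconjBy

theorem b_pow_mul_a_sq {k : ℕ} (hk : Odd k) :
    (b m n ^ k) ^ 2 = (b m n ^ k * a m n) ^ 2 := by
  rw [sq, sq, mul_assoc, ← mul_assoc (a m n), (semiconjBy_b_pow hk).mul_mul_eq_of_inv]

/-- The homomorphism `x ↦ b ^ n²`, `y ↦ a`. -/
def ofBinaryDihedral (m : ℕ) (hn : Odd n) : BinaryDihedral m →* Gmn m n :=
  BinaryDihedral.lift (b m n ^ n ^ 2) (a m n) (b_pow_mul_a_sq hn.pow) (by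
    rw [← b_pow_mul_a_sq hn.pow, ← pow_mul, show n ^ 2 * 2 = 2 * n * n by ring, pow_mul,
      pow_eq_self_of_sq_eq_one b_pow_sq hn, b_pow_two_mul])

theorem ofBinaryDihedral_x (hn : Odd n) :
    ofBinaryDihedral m hn (BinaryDihedral.x m) = b m n ^ n ^ 2 :=
  BinaryDihedral.lift_x _ _ _ _

theorem ofBinaryDihedral_y (hn : Odd n) :
    ofBinaryDihedral m hn (BinaryDihedral.y m) = a m n :=
  BinaryDihedral.lift_y _ _ _ _

theorem toProd_a (hn : Odd n) : toProd m hn (a m n) = (BinaryDihedral.y m, 1) :=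
  lift_a _ _ _ _

theorem toProd_b (hn : Odd n) :
    toProd m hn (b m n) = (BinaryDihedral.x m, Multiplicative.ofAdd 1) :=
  lift_b _ _ _ _

theorem exists_sq_eq (hn : Odd n) : ∃ t, n ^ 2 = 4 * t + 1 := by
  obtain ⟨k, rfl⟩ := hn
  exact ⟨k ^ 2 + k, by ring⟩

theorem inv_b_pow_mul_b {t : ℕ} (ht : n ^ 2 = 4 * t + 1) :
    (b m n ^ n ^ 2)⁻¹ * b m n = (b m n ^ (4 * t))⁻¹ := by
  rw [ht, pow_succ']
  group

/-- The homomorphism `c ↦ b ^ (1 - n²)`. -/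
def ofCyclic (m : ℕ) (hn : Odd n) : Multiplicative (ZMod n) →* Gmn m n :=
  cyclicLift n ((b m n ^ n ^ 2)⁻¹ * b m n) (by
    obtain ⟨t, ht⟩ := exists_sq_eq hn
    rw [inv_b_pow_mul_b ht, inv_pow, ← pow_mul, show 4 * t * n = 2 * n * 2 * t by ring, pow_mul,
      pow_mul, b_pow_sq, one_pow, inv_one])

theorem ofCyclic_ofAdd_one (hn : Odd n) :
    ofCyclic m hn (Multiplicative.ofAdd 1) = (b m n ^ n ^ 2)⁻¹ * b m n :=
  cyclicLift_ofAdd_one _ _ _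

theorem commute_ofAdd_one (hn : Odd n) (g : BinaryDihedral m) :
    Commute (ofBinaryDihedral m hn g) (ofCyclic m hn (Multiplicative.ofAdd 1)) := by
  rw [ofCyclic_ofAdd_one]
  set w := (b m n ^ n ^ 2)⁻¹ * b m n with hw
  have key : (MulAut.conj w).toMonoidHom.comp (ofBinaryDihedral m hn) = ofBinaryDihedral m hn := by
    refine BinaryDihedral.hom_ext ?_ ?_
    · change w * ofBinaryDihedral m hn (BinaryDihedral.x m) * w⁻¹ = _
      rw [ofBinaryDihedral_x, mul_inv_eq_iff_eq_mul, hw]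
      exact ((Commute.refl _).inv_left.mul_left (Commute.self_pow _ _)).eq
    · change w * ofBinaryDihedral m hn (BinaryDihedral.y m) * w⁻¹ = _
      obtain ⟨t, ht⟩ := exists_sq_eq hn
      rw [ofBinaryDihedral_y, mul_inv_eq_iff_eq_mul, hw, inv_b_pow_mul_b ht,
        show 4 * t = 2 * (2 * t) by ring]
      exact (commute_b_pow _).inv_left.eq
  have h : w * ofBinaryDihedral m hn g * w⁻¹ = ofBinaryDihedral m hn g := DFunLike.congr_fun key g
  exact (mul_inv_eq_iff_eq_mul.1 h).symm

theorem commute_ofBinaryDihedral_ofCyclic (hn : Odd n) (g : BinaryDihedral m)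
    (c : Multiplicative (ZMod n)) : Commute (ofBinaryDihedral m hn g) (ofCyclic m hn c) := by
  obtain ⟨k, hk⟩ := ZMod.intCast_surjective c.toAdd
  rw [← ofAdd_toAdd c, ← hk, ← ofAdd_one_zpow, map_zpow]
  exact (commute_ofAdd_one hn g).zpow_right k

/-- The homomorphism `x ↦ b ^ n²`, `y ↦ a`, `c ↦ b ^ (1 - n²)`, inverse to `toProd`. -/
def ofProd (m : ℕ) (hn : Odd n) : BinaryDihedral m × Multiplicative (ZMod n) →* Gmn m n :=
  (ofBinaryDihedral m hn).noncommCoprod (ofCyclic m hn) (commute_ofBinaryDihedral_ofCyclic hn)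

theorem ofProd_apply (hn : Odd n) (p : BinaryDihedral m × Multiplicative (ZMod n)) :
    ofProd m hn p = ofBinaryDihedral m hn p.1 * ofCyclic m hn p.2 :=
  rfl

theorem ofProd_comp_toProd (hn : Odd n) : (ofProd m hn).comp (toProd m hn) = MonoidHom.id _ := by
  refine hom_ext ?_ ?_
  · rw [MonoidHom.comp_apply, toProd_a, ofProd_apply, ofBinaryDihedral_y, map_one, mul_one,
      MonoidHom.id_apply]
  · rw [MonoidHom.comp_apply, toProd_b, ofProd_apply, ofBinaryDihedral_x, ofCyclic_ofAdd_one,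
      mul_inv_cancel_left, MonoidHom.id_apply]

theorem toProd_b_pow (hn : Odd n) : toProd m hn (b m n ^ n ^ 2) = (BinaryDihedral.x m, 1) := by
  rw [map_pow, toProd_b]
  refine Prod.ext ?_ ?_
  · change BinaryDihedral.x m ^ n ^ 2 = BinaryDihedral.x m
    obtain ⟨t, ht⟩ := exists_sq_eq hn
    rw [ht, pow_succ, show 4 * t = 2 * 2 * t by ring, pow_mul, pow_mul, BinaryDihedral.x_sq_sq,
      one_pow, one_mul]
  · change Multiplicative.ofAdd (1 : ZMod n) ^ n ^ 2 = 1
    rw [sq, pow_mul, ofAdd_one_pow_self, one_pow]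

theorem toProd_comp_ofBinaryDihedral (hn : Odd n) :
    (toProd m hn).comp (ofBinaryDihedral m hn) = MonoidHom.inl _ _ := by
  refine BinaryDihedral.hom_ext ?_ ?_
  · rw [MonoidHom.comp_apply, ofBinaryDihedral_x, toProd_b_pow, MonoidHom.inl_apply]
  · rw [MonoidHom.comp_apply, ofBinaryDihedral_y, toProd_a, MonoidHom.inl_apply]

theorem toProd_comp_ofCyclic (hn : Odd n) :
    (toProd m hn).comp (ofCyclic m hn) = MonoidHom.inr _ _ := by
  refine cyclic_hom_ext ?_
  rw [MonoidHom.comp_apply, ofCyclic_ofAdd_one, map_mul, map_inv, toProd_b_pow, toProd_b,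
    MonoidHom.inr_apply, Prod.inv_mk, Prod.mk_mul_mk, inv_mul_cancel, inv_one, one_mul]

theorem toProd_comp_ofProd (hn : Odd n) : (toProd m hn).comp (ofProd m hn) = MonoidHom.id _ := by
  refine MonoidHom.ext fun p => ?_
  have h₁ := DFunLike.congr_fun (toProd_comp_ofBinaryDihedral (m := m) hn) p.1
  have h₂ := DFunLike.congr_fun (toProd_comp_ofCyclic (m := m) hn) p.2
  rw [MonoidHom.comp_apply] at h₁ h₂
  rw [MonoidHom.comp_apply, ofProd_apply, map_mul, h₁, h₂, MonoidHom.inl_apply,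
    MonoidHom.inr_apply, Prod.mk_mul_mk, mul_one, one_mul, MonoidHom.id_apply]

/-- For odd `n`, the group `G(m,n)` is the product of a binary dihedral and a cyclic group. -/
def equivProd (m : ℕ) (hn : Odd n) :
    Gmn m n ≃* BinaryDihedral m × Multiplicative (ZMod n) :=
  (toProd m hn).toMulEquiv (ofProd m hn) (ofProd_comp_toProd hn) (toProd_comp_ofProd hn)

end Gmn

/-- For every even `m ≥ 2` and `n ≥ 1` with `gcd(m,n) = 1`, the group `G(m,n)`
is isomorphic to `D*₄ₘ × Cₙ`. -/
theorem stmt1 (m n : ℕ) (hm : 2 ≤ m) (hmeven : Even m) (hn : 1 ≤ n)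
    (hmn : Nat.gcd m n = 1) :
    Nonempty (Gmn m n ≃* BinaryDihedral m × Multiplicative (ZMod n)) := by
  exact ⟨Gmn.equivProd m ((Nat.Coprime.coprime_dvd_left hmeven.two_dvd hmn).odd_of_left)⟩
end

section
/- Let m > 1 be odd and let n ≥ 1 satisfy gcd(m,n) = 1, and write 4n = 2ᵏn₁ with n₁ odd. Then the group G(m,n) is isomorphic to the direct product D₍₂ᵏ,ₘ₎ × C_{n₁} of the generalized dihedral group D₍₂ᵏ,ₘ₎ and the cyclic group of order n₁. -/
/-- A homomorphism out of `Multiplicative (ZMod n)` given by an element killed by `n`. -/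
def zmodPowHom {G : Type*} [Group G] (n : ℕ) (z : G) (hz : z ^ n = 1) :
    Multiplicative (ZMod n) →* G :=
  AddMonoidHom.toMultiplicativeLeft
    (ZMod.lift n ⟨zmultiplesHom (Additive G) (Additive.ofMul z), by
      simp [← ofMul_pow, hz]⟩)

theorem zmodPowHom_ofAdd_one {G : Type*} [Group G] (n : ℕ) (z : G) (hz : z ^ n = 1) :
    zmodPowHom n z hz (Multiplicative.ofAdd 1) = z := by
  have h := ZMod.lift_coe n ⟨zmultiplesHom (Additive G) (Additive.ofMul z), by
      simp [← ofMul_pow, hz]⟩ 1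
  simp only [Int.cast_one, zmultiplesHom_apply, one_smul] at h
  simp only [zmodPowHom, AddMonoidHom.toMultiplicativeLeft_apply_apply, toAdd_ofAdd, h,
    toMul_ofMul]

theorem exists_zpow_ofAdd_one {n : ℕ} (c : Multiplicative (ZMod n)) :
    ∃ j : ℤ, c = Multiplicative.ofAdd 1 ^ j := by
  obtain ⟨j, hj⟩ := ZMod.intCast_surjective c.toAdd
  exact ⟨j, by rw [← ofAdd_zsmul, zsmul_one, hj, ofAdd_toAdd]⟩

theorem multiplicative_zmod_hom_ext {n : ℕ} {G : Type*} [Group G]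
    {f g : Multiplicative (ZMod n) →* G}
    (h : f (Multiplicative.ofAdd 1) = g (Multiplicative.ofAdd 1)) : f = g := by
  refine MonoidHom.ext fun c => ?_
  obtain ⟨j, rfl⟩ := exists_zpow_ofAdd_one c
  rw [map_zpow, map_zpow, h]

theorem ofAdd_pow_eq_one {n : ℕ} (c : Multiplicative (ZMod n)) : c ^ n = 1 := by
  apply Multiplicative.toAdd.injective
  simp

theorem PresentedGroup.mem_center_of_commute {α : Type*} {rels : Set (FreeGroup α)}
    {z : PresentedGroup rels} (h : ∀ x, Commute z (PresentedGroup.of x)) :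
    z ∈ Subgroup.center (PresentedGroup rels) := by
  have key : (MulAut.conj z).toMonoidHom = MonoidHom.id _ := by
    refine PresentedGroup.ext fun x => ?_
    simp [(h x).eq]
  refine Subgroup.mem_center_iff.2 fun g => ?_
  have := DFunLike.congr_fun key g
  simp only [MulEquiv.toMonoidHom_eq_coe, MonoidHom.coe_coe, MulAut.conj_apply,
    MonoidHom.id_apply] at this
  exact (mul_inv_eq_iff_eq_mul.1 this).symm

section Inversion

variable {G : Type*} [Group G] {a b : G}

/-- If `b` inverts `a`, then `b` inverts every power of `a`. -/
theorem inv_mul_pow_mul_mul_pow (h : b⁻¹ * a * b * a = 1) (j : ℕ) :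
    b⁻¹ * a ^ j * b * a ^ j = 1 := by
  have h1 : b⁻¹ * a * b⁻¹⁻¹ = a⁻¹ := by rw [inv_inv]; exact eq_inv_of_mul_eq_one_left h
  have h2 := conj_pow (i := j) (a := b⁻¹) (b := a)
  rw [h1, inv_inv] at h2
  rw [← h2, inv_pow, inv_mul_cancel]

theorem commute_pow_of_even (h : b⁻¹ * a * b * a = 1) {e : ℕ} (he : Even e) :
    Commute (b ^ e) a := by
  have h1 : a * b = b * a⁻¹ := by
    rw [eq_mul_inv_iff_mul_eq]
    calc a * b * a = b * (b⁻¹ * a * b * a) := by group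
      _ = b := by rw [h, mul_one]
  have h2 : SemiconjBy b a⁻¹ a := h1.symm
  have h3 : SemiconjBy b a a⁻¹ := by simpa using h2.inv_right
  obtain ⟨r, rfl⟩ := he
  rw [← two_mul, pow_mul, pow_two]
  exact Commute.pow_left (h2.mul_left h3) r

/-- If `b` inverts `a`, then so does every odd power of `b`. -/
theorem inv_pow_mul_mul_pow_mul (h : b⁻¹ * a * b * a = 1) {e : ℕ} (he : Odd e) :
    (b ^ e)⁻¹ * a * b ^ e * a = 1 := by
  obtain ⟨r, rfl⟩ := he
  have hc := commute_pow_of_even h (even_two_mul r)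
  calc (b ^ (2 * r + 1))⁻¹ * a * b ^ (2 * r + 1) * a
      = b⁻¹ * ((b ^ (2 * r))⁻¹ * (a * b ^ (2 * r))) * b * a := by rw [pow_succ]; group
    _ = 1 := by rw [← hc.eq, inv_mul_cancel_left, h]

theorem pow_two_mul_eq_one {m n : ℕ} (h : b⁻¹ * a * b * a = 1)
    (hs : a ^ m * b ^ (2 * n) = 1) : a ^ (2 * m) = 1 := by
  have h1 : Commute (a ^ m) b := by
    rw [eq_inv_of_mul_eq_one_left hs]
    exact (Commute.pow_self b _).inv_left
  have h2 := inv_mul_pow_mul_mul_pow h m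
  rw [mul_assoc b⁻¹, h1.eq, inv_mul_cancel_left] at h2
  rw [two_mul, pow_add, h2]

theorem pow_four_mul_eq_one {m n : ℕ} (h : b⁻¹ * a * b * a = 1)
    (hs : a ^ m * b ^ (2 * n) = 1) : b ^ (4 * n) = 1 := by
  rw [show 4 * n = 2 * n * 2 by ring, pow_mul, eq_inv_of_mul_eq_one_right hs, inv_pow,
    ← pow_mul, mul_comm m, pow_two_mul_eq_one h hs, inv_one]

end Inversion

section Presentations

variable {H : Type*} [Group H]

/-- The universal property of `Gmn m n`. -/
def Gmn.lift_s2 {m n : ℕ} (a b : H) (h : b⁻¹ * a * b * a = 1) (hs : a ^ m * b ^ (2 * n) = 1) :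
    Gmn m n →* H :=
  PresentedGroup.toGroup (f := ![a, b]) (by
    rintro r (rfl | rfl)
    · simpa using h
    · simpa using hs)

/-- The universal property of `GenDihedral k m`. -/
def GenDihedral.lift_s2 {k m : ℕ} (x y : H) (hx : x ^ 2 ^ k = 1) (hy : y ^ m = 1)
    (h : x⁻¹ * y * x * y = 1) : GenDihedral k m →* H :=
  PresentedGroup.toGroup (f := ![x, y]) (by
    rintro r (rfl | rfl | rfl)
    · simpa using hx
    · simpa using hy
    · simpa using h)

variable (m n k : ℕ)

theorem Gmn.klein_relation :
    (PresentedGroup.of 1 : Gmn m n)⁻¹ * PresentedGroup.of 0 * PresentedGroup.of 1 *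
      PresentedGroup.of 0 = 1 :=
  PresentedGroup.one_of_mem (rels := {kleinRel, surgeryRel m n}) (Or.inl rfl)

theorem Gmn.surgery_relation :
    (PresentedGroup.of 0 : Gmn m n) ^ m * PresentedGroup.of 1 ^ (2 * n) = 1 :=
  PresentedGroup.one_of_mem (rels := {kleinRel, surgeryRel m n}) (Or.inr rfl)

theorem GenDihedral.pow_two_pow : (PresentedGroup.of 0 : GenDihedral k m) ^ 2 ^ k = 1 :=
  PresentedGroup.one_of_mem (x := FreeGroup.of 0 ^ 2 ^ k) (Or.inl rfl)

theorem GenDihedral.pow_eq_one : (PresentedGroup.of 1 : GenDihedral k m) ^ m = 1 :=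
  PresentedGroup.one_of_mem (x := FreeGroup.of 1 ^ m) (Or.inr (Or.inl rfl))

theorem GenDihedral.inversion_relation :
    (PresentedGroup.of 0 : GenDihedral k m)⁻¹ * PresentedGroup.of 1 * PresentedGroup.of 0 *
      PresentedGroup.of 1 = 1 :=
  PresentedGroup.one_of_mem
    (x := (FreeGroup.of 0)⁻¹ * FreeGroup.of 1 * FreeGroup.of 0 * FreeGroup.of 1)
    (Or.inr (Or.inr rfl))

end Presentations

/-- For odd `m > 1` and `n ≥ 1` with `gcd(m,n) = 1`, writing `4n = 2ᵏ n₁` with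
`n₁` odd, the group `G(m,n)` is isomorphic to `D₍₂ᵏ,ₘ₎ × C_{n₁}`. -/
theorem stmt2 (m n k n₁ : ℕ) (hm : 1 < m) (hmodd : Odd m) (hn : 1 ≤ n)
    (hmn : Nat.gcd m n = 1) (hk : 4 * n = 2 ^ k * n₁) (hn₁ : Odd n₁) :
    Nonempty (Gmn m n ≃* GenDihedral k m × Multiplicative (ZMod n₁)) := by
  obtain ⟨t, ht⟩ : 4 ∣ 2 ^ k := by
    have h4 : Nat.Coprime 4 n₁ := (Nat.Coprime.pow_left 2 hn₁.coprime_two_left : _)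
    exact h4.dvd_of_dvd_mul_right ⟨n, hk.symm⟩
  have hnt : n = t * n₁ := by rw [ht, mul_assoc] at hk; omega
  have hcop : Nat.Coprime (2 ^ k) n₁ := Nat.Coprime.pow_left k hn₁.coprime_two_left
  obtain ⟨e, he, he'⟩ := Nat.chineseRemainder hcop 1 0
  obtain ⟨s, hs, hs'⟩ := Nat.chineseRemainder hcop 0 1
  have hes : e + s ≡ 1 [MOD 4 * n] := by
    rw [hk, ← Nat.modEq_and_modEq_iff_modEq_mul hcop]
    exact ⟨he.add hs, he'.add hs'⟩
  have h2k : 2 ∣ 2 ^ k := ⟨2 * t, by omega⟩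
  have heodd : Odd e := Nat.odd_iff.2 (he.of_dvd h2k)
  have hseven : Even s := Nat.even_iff.2 (hs.of_dvd h2k)
  obtain ⟨q, hq⟩ : 2 ∣ m + 1 := hmodd.add_one.two_dvd
  -- the homomorphism from `Gmn m n`
  set x : GenDihedral k m := PresentedGroup.of 0
  set y : GenDihedral k m := PresentedGroup.of 1
  set g : Multiplicative (ZMod n₁) := Multiplicative.ofAdd 1
  have hx : x ^ 2 ^ k = 1 := GenDihedral.pow_two_pow m k
  have hy : y ^ m = 1 := GenDihedral.pow_eq_one m k
  have hxy : x⁻¹ * y * x * y = 1 := GenDihedral.inversion_relation m k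
  have hg : g ^ n₁ = 1 := ofAdd_pow_eq_one g
  have hx4 : x ^ (4 * n) = 1 := by rw [hk, pow_mul, hx, one_pow]
  have hg2 : g ^ (2 * n) = 1 := by
    rw [hnt, ← mul_assoc, mul_comm, pow_mul, hg, one_pow]
  have hcxy : Commute (x ^ (2 * n)) y := commute_pow_of_even hxy (even_two_mul n)
  have hxq : x ^ (2 * n * (m + 1)) = 1 := by
    rw [hq, show 2 * n * (2 * q) = 4 * n * q by ring, pow_mul, hx4, one_pow]
  have hyx (j : ℕ) : (y * x ^ (2 * n)) ^ j = y ^ j * x ^ (2 * n * j) := by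
    rw [hcxy.symm.mul_pow, ← pow_mul]
  let f : Gmn m n →* GenDihedral k m × Multiplicative (ZMod n₁) :=
    Gmn.lift_s2 (y * x ^ (2 * n), 1) (x, g)
      (by
        ext1
        · calc x⁻¹ * (y * x ^ (2 * n)) * x * (y * x ^ (2 * n))
              = x⁻¹ * y * x * (x ^ (2 * n) * y) * x ^ (2 * n) := by group
            _ = x⁻¹ * y * x * y * x ^ (4 * n) := by rw [hcxy.eq]; group
            _ = 1 := by rw [hxy, hx4, one_mul]
        · simp)
      (by
        ext1
        · simp only [Prod.pow_mk, Prod.mk_mul_mk, Prod.fst_one]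
          rw [hyx, hy, one_mul, ← pow_add, ← hxq]
          ring_nf
        · simp [hg2])
  have hfa : f (PresentedGroup.of 0) = (y * x ^ (2 * n), 1) := PresentedGroup.toGroup.of _
  have hfb : f (PresentedGroup.of 1) = (x, g) := PresentedGroup.toGroup.of _
  -- the homomorphism to `Gmn m n`
  set a : Gmn m n := PresentedGroup.of 0
  set b : Gmn m n := PresentedGroup.of 1
  have hab : b⁻¹ * a * b * a = 1 := Gmn.klein_relation m n
  have hsur : a ^ m * b ^ (2 * n) = 1 := Gmn.surgery_relation m n
  have ha2 : a ^ (2 * m) = 1 := pow_two_mul_eq_one hab hsur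
  have hb4 : b ^ (4 * n) = 1 := pow_four_mul_eq_one hab hsur
  let φ : GenDihedral k m →* Gmn m n :=
    GenDihedral.lift_s2 (b ^ e) (a ^ (m + 1))
      (by
        rw [← pow_mul, ← pow_zero b]
        refine pow_eq_pow_of_modEq ?_ hb4
        rw [hk, mul_comm]
        simpa using he'.mul_right' (2 ^ k))
      (by rw [← pow_mul, hq, show 2 * q * m = 2 * m * q by ring, pow_mul, ha2, one_pow])
      (inv_mul_pow_mul_mul_pow (inv_pow_mul_mul_pow_mul hab heodd) (m + 1))
  let ψ : Multiplicative (ZMod n₁) →* Gmn m n :=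
    zmodPowHom n₁ (b ^ s) (by
      rw [← pow_mul, ← pow_zero b]
      refine pow_eq_pow_of_modEq ?_ hb4
      rw [hk]
      simpa using hs.mul_right' n₁)
  have hφx : φ x = b ^ e := PresentedGroup.toGroup.of _
  have hφy : φ y = a ^ (m + 1) := PresentedGroup.toGroup.of _
  have hψg : ψ g = b ^ s := zmodPowHom_ofAdd_one _ _ _
  have hcen : b ^ s ∈ Subgroup.center (Gmn m n) := by
    refine PresentedGroup.mem_center_of_commute fun i => ?_
    fin_cases i
    · exact commute_pow_of_even hab hseven
    · exact Commute.pow_self b s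
  have hcomm (d : GenDihedral k m) (c : Multiplicative (ZMod n₁)) : Commute (φ d) (ψ c) := by
    obtain ⟨j, rfl⟩ := exists_zpow_ofAdd_one c
    rw [map_zpow, hψg]
    exact Subgroup.mem_center_iff.1 (zpow_mem hcen j) (φ d)
  let h := φ.noncommCoprod ψ hcomm
  refine ⟨MonoidHom.toMulEquiv f h (PresentedGroup.ext fun i => ?_) ?_⟩
  · have hb1 : h (x, g) = b := by
      rw [MonoidHom.noncommCoprod_apply, hφx, hψg, ← pow_add, pow_eq_pow_of_modEq hes hb4,
        pow_one]
    have hbn : φ x ^ (2 * n) = b ^ (2 * n) := by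
      have h1 := congrArg (· ^ (2 * n)) hb1
      simp only [← map_pow, Prod.pow_mk, hg2] at h1
      rw [← h1, MonoidHom.noncommCoprod_apply, map_one, mul_one, map_pow]
    fin_cases i
    · change h (f a) = a
      rw [hfa, MonoidHom.noncommCoprod_apply, map_one, mul_one, map_mul, map_pow, hφy, hbn,
        pow_succ', mul_assoc, hsur, mul_one]
    · change h (f b) = b
      rw [hfb, hb1]
  · have hfφ : f.comp φ = MonoidHom.inl _ _ := by
      refine PresentedGroup.ext fun i => ?_
      fin_cases i
      · change f (φ x) = (x, 1)
        rw [hφx, map_pow, hfb, Prod.pow_mk, pow_eq_pow_of_modEq he hx,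
          pow_eq_pow_of_modEq he' hg, pow_one, pow_zero]
      · change f (φ y) = (y, 1)
        rw [hφy, map_pow, hfa, Prod.pow_mk, hyx, hxq, pow_succ, hy, one_mul, mul_one, one_pow]
    have hfψ : f.comp ψ = MonoidHom.inr _ _ := by
      refine multiplicative_zmod_hom_ext ?_
      change f (ψ g) = (1, g)
      rw [hψg, map_pow, hfb, Prod.pow_mk, pow_eq_pow_of_modEq hs hx,
        pow_eq_pow_of_modEq hs' hg, pow_one, pow_zero]
    ext1 ⟨d, c⟩
    have h1 : f (φ d) = (d, 1) := DFunLike.congr_fun hfφ d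
    have h2 : f (ψ c) = (1, c) := DFunLike.congr_fun hfψ c
    change f (h (d, c)) = (d, c)
    rw [MonoidHom.noncommCoprod_apply, map_mul, h1, h2, Prod.mk_mul_mk, mul_one, one_mul]
end

section
/- Let m and n be coprime positive integers with (m,n) ≠ (1,1). Then in the group G(m,n) = ⟨a, b | b⁻¹ab = a⁻¹, aᵐb²ⁿ = 1⟩, the elements ab² and ab⁻² are both nontrivial. -/
/-- Sending `a` to a rotation and `b` to a reflection defines a map onto the dihedral group of
order `2m`. -/
def Gmn.toDihedral (m n : ℕ) : Gmn m n →* DihedralGroup m :=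
  PresentedGroup.toGroup (f := ![DihedralGroup.r 1, DihedralGroup.sr 0]) (by
    rintro r (rfl | rfl)
    · simp [kleinRel]
    · simp [surgeryRel, pow_mul, pow_two])

/-- For `m = 1`, sending `a` to `2n` and `b` to `1` defines a map onto `ℤ/4n`. -/
def Gmn.toCyclic (n : ℕ) : Gmn 1 n →* Multiplicative (ZMod (4 * n)) :=
  PresentedGroup.toGroup
    (f := ![Multiplicative.ofAdd ((2 * n : ℕ) : ZMod (4 * n)), Multiplicative.ofAdd 1]) (by
    have h0 : ((2 * n : ℕ) : ZMod (4 * n)) + ((2 * n : ℕ) : ZMod (4 * n)) = 0 := by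
      rw [← Nat.cast_add, show 2 * n + 2 * n = 4 * n by ring, ZMod.natCast_self]
    rintro r (rfl | rfl)
    · apply Multiplicative.toAdd.injective
      simpa [kleinRel] using h0
    · apply Multiplicative.toAdd.injective
      simpa [surgeryRel] using h0)

/-- For coprime positive integers `m`, `n` with `(m,n) ≠ (1,1)`, the elements
`a b²` and `a b⁻²` of `G(m,n)` are nontrivial. -/
theorem stmt5 (m n : ℕ) (hm : 1 ≤ m) (hn : 1 ≤ n) (hmn : Nat.gcd m n = 1)
    (h : ¬(m = 1 ∧ n = 1)) :
    (PresentedGroup.of 0 : Gmn m n) * PresentedGroup.of 1 ^ 2 ≠ 1 ∧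
    (PresentedGroup.of 0 : Gmn m n) * (PresentedGroup.of 1 ^ 2)⁻¹ ≠ 1 := by
  obtain hm2 | rfl : 2 ≤ m ∨ m = 1 := by omega
  · have : Fact (1 < m) := ⟨hm2⟩
    have hr : (DihedralGroup.r 1 : DihedralGroup m) ≠ 1 := fun h1 =>
      one_ne_zero (DihedralGroup.r.inj h1)
    constructor <;> intro h1 <;> replace h1 := congrArg (Gmn.toDihedral m n) h1 <;>
      exact hr (by simpa [Gmn.toDihedral, pow_two] using h1)
  · have hn2 : 2 ≤ n := by omega
    constructor <;> intro h1 <;>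
      replace h1 := congrArg (fun x => (Gmn.toCyclic n x).toAdd) h1
    · have h2 : ((2 * n + 2 : ℕ) : ZMod (4 * n)) = 0 := by
        simpa [Gmn.toCyclic] using h1
      rw [ZMod.natCast_eq_zero_iff] at h2
      have := Nat.le_of_dvd (by omega) h2
      omega
    · have h2 : ((2 * n - 2 : ℕ) : ZMod (4 * n)) = 0 := by
        rw [Nat.cast_sub (by omega)]
        simpa [Gmn.toCyclic, sub_eq_add_neg] using h1
      rw [ZMod.natCast_eq_zero_iff] at h2
      have := Nat.le_of_dvd (by omega) h2
      omega
end

section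
/- For every integer n ≥ 2, in the group G(1,n) = ⟨a, b | b⁻¹ab = a⁻¹, ab²ⁿ = 1⟩ the element a equals b²ⁿ, and a is not equal to b². -/
/-- In any group, if `b⁻¹ a b a = 1` and `a b ^ k = 1`, then `a = b ^ k`. -/
theorem eq_pow_of_klein_relations {G : Type*} [Group G] {a b : G} {k : ℕ}
    (h₁ : b⁻¹ * a * b * a = 1) (h₂ : a * b ^ k = 1) : a = b ^ k := by
  have ha : a = (b ^ k)⁻¹ := eq_inv_of_mul_eq_one_left h₂
  have hc : Commute b a := ha ▸ (Commute.self_pow b k).inv_right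
  have hsq : a * a = 1 := by
    rwa [mul_assoc b⁻¹, ← hc.eq, inv_mul_cancel_left] at h₁
  exact mul_left_cancel (hsq.trans h₂.symm)

/-- The homomorphism `G(1,n) → ℤ/4n` sending `a` to `2n` and `b` to `1`. -/
def gmnOneToZMod (n : ℕ) : Gmn 1 n →* Multiplicative (ZMod (4 * n)) :=
  PresentedGroup.toGroup
    (f := ![Multiplicative.ofAdd ((2 * n : ℕ) : ZMod (4 * n)), Multiplicative.ofAdd 1]) <| by
    have h : ((2 * n : ℕ) : ZMod (4 * n)) + (2 * n : ℕ) = 0 := by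
      rw [← Nat.cast_add, show 2 * n + 2 * n = 4 * n by ring, ZMod.natCast_self]
    rintro r (rfl | rfl)
    · apply Multiplicative.toAdd.injective
      simpa [kleinRel] using h
    · apply Multiplicative.toAdd.injective
      simpa [surgeryRel] using h

/-- For `n ≥ 2`, in `G(1,n)` the element `a` equals `b²ⁿ`, and `a ≠ b²`. -/
theorem stmt6 (n : ℕ) (hn : 2 ≤ n) :
    (PresentedGroup.of 0 : Gmn 1 n) = PresentedGroup.of 1 ^ (2 * n) ∧
    (PresentedGroup.of 0 : Gmn 1 n) ≠ PresentedGroup.of 1 ^ 2 := by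
  constructor
  · have h₁ := PresentedGroup.one_of_mem
      (rels := ({kleinRel, surgeryRel 1 n} : Set (FreeGroup (Fin 2)))) (x := kleinRel) (by simp)
    have h₂ := PresentedGroup.one_of_mem
      (rels := ({kleinRel, surgeryRel 1 n} : Set (FreeGroup (Fin 2)))) (x := surgeryRel 1 n)
      (by simp)
    simp only [kleinRel, surgeryRel, map_mul, map_inv, map_pow, pow_one] at h₁ h₂
    exact eq_pow_of_klein_relations h₁ h₂
  · intro h
    have h' := congrArg (fun x => (gmnOneToZMod n x).toAdd) h
    simp only [gmnOneToZMod, map_pow, PresentedGroup.toGroup.of, Matrix.cons_val_zero,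
      Matrix.cons_val_one, toAdd_pow, toAdd_ofAdd, nsmul_one] at h'
    rw [ZMod.natCast_eq_natCast_iff] at h'
    have := h'.eq_of_lt_of_lt (by omega) (by omega)
    omega
end

section
/- For every integer m ≥ 2, in the group G(m,1) = ⟨a, b | b⁻¹ab = a⁻¹, aᵐb² = 1⟩ the element a is not conjugate to b². -/
/-- In the generalized quaternion group `⟨a, x⟩` of order `4m`, the relations of `G(m,1)` hold
for the generators `a` and `x`. -/
theorem lift_quaternionGroup_eq_one (m : ℕ) :
    ∀ r ∈ ({kleinRel, surgeryRel m 1} : Set (FreeGroup (Fin 2))),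
      FreeGroup.lift ![QuaternionGroup.a (1 : ZMod (2 * m)), QuaternionGroup.xa 0] r = 1 := by
  have hm : (m : ZMod (2 * m)) + m = 0 := by
    rw [← two_mul]
    exact_mod_cast ZMod.natCast_self (2 * m)
  rintro r (rfl | rfl)
  · simp only [map_mul, map_inv, FreeGroup.lift_apply_of, Matrix.cons_val_zero,
      Matrix.cons_val_one, mul_assoc, inv_mul_eq_one]
    simp
  · simp [pow_two, hm]

/-- For `m ≥ 2`, in the generalized quaternion group `⟨a, x⟩` of order `4m` the element `a` is
not conjugate to `x²`, which is central. -/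
theorem not_isConj_quaternionGroup_a_one_xa_zero_sq {m : ℕ} (hm : 2 ≤ m) :
    ¬ IsConj (QuaternionGroup.a (1 : ZMod (2 * m))) (QuaternionGroup.xa 0 ^ 2) := by
  have hne : (m : ZMod (2 * m)) ≠ 1 := by
    rw [← Nat.cast_one, Ne, ZMod.natCast_eq_natCast_iff', Nat.mod_eq_of_lt (by lia),
      Nat.mod_eq_of_lt (by lia)]
    lia
  have hneg : -(m : ZMod (2 * m)) = m := by
    rw [neg_eq_iff_add_eq_zero, ← two_mul]
    exact_mod_cast ZMod.natCast_self (2 * m)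
  intro h
  obtain ⟨c, hc⟩ := isConj_iff.mp h.symm
  rw [mul_inv_eq_iff_eq_mul] at hc
  rcases c with i | i
  · exact hne (by simpa [pow_two, add_comm] using hc)
  · have hm' : (m : ZMod (2 * m)) = -1 := by simpa [pow_two, sub_eq_add_neg] using hc
    exact hne (by rw [← hneg, hm', neg_neg])

/-- For `m ≥ 2`, in `G(m,1)` the element `a` is not conjugate to `b²`. -/
theorem stmt7 (m : ℕ) (hm : 2 ≤ m) :
    ¬ IsConj (PresentedGroup.of 0 : Gmn m 1) (PresentedGroup.of 1 ^ 2) := by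
  intro h
  have h' := (PresentedGroup.toGroup (lift_quaternionGroup_eq_one m)).map_isConj h
  rw [map_pow, PresentedGroup.toGroup.of, PresentedGroup.toGroup.of] at h'
  exact not_isConj_quaternionGroup_a_one_xa_zero_sq hm h'
end

section
/- Every ℝ-linear isometry f of the quaternion algebra ℍ ≅ ℝ⁴ with determinant 1 is of the form f(q) = a·q·b⁻¹ for some unit quaternions a and b. That is, the homomorphism F : S³ × S³ → SO(4) defined by F(a,b)(q) = a·q·b⁻¹ is surjective onto the group of orientation-preserving linear isometries of ℝ⁴. -/
namespace Quaternion

/-- The reflection of `ℍ` in the hyperplane orthogonal to a unit quaternion `v` is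
`q ↦ -(v * star q * v)`. -/
theorem reflection_orthogonal_span_singleton_apply {v : Quaternion ℝ} (hv : ‖v‖ = 1)
    (q : Quaternion ℝ) :
    (Submodule.span ℝ {v})ᗮ.reflection q = -(v * star q * v) := by
  have hpolar : (q * star v + v * star q) * v = (2 * inner ℝ v q) • v := by
    have h : q * star v + v * star q = ((2 * inner ℝ v q : ℝ) : Quaternion ℝ) := by
      have := self_add_star (v * star q)
      rw [star_mul, star_star, add_comm] at this
      rw [this, inner_def]
      push_cast
      rfl
    rw [h, coe_mul_eq_smul]
  have hvv : star v * v = 1 := by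
    rw [star_mul_self, normSq_eq_norm_mul_self, hv, mul_one, coe_one]
  rw [add_mul, mul_assoc q, hvv, mul_one] at hpolar
  rw [Submodule.reflection_orthogonal_apply, Submodule.reflection_singleton_apply, hv,
    eq_sub_of_add_eq' hpolar]
  simp [two_smul, two_mul, add_smul]

/-- A linear isometry of `ℍ` is `q ↦ a * q * b` if it preserves orientation and
`q ↦ a * star q * b` if it reverses orientation, for some unit quaternions `a` and `b`. -/
theorem exists_linearIsometryEquiv_eq (φ : Quaternion ℝ ≃ₗᵢ[ℝ] Quaternion ℝ) :
    ∃ a b : Quaternion ℝ, ‖a‖ = 1 ∧ ‖b‖ = 1 ∧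
      ((LinearMap.det φ.toLinearMap = 1 ∧ ∀ q, φ q = a * q * b) ∨
        (LinearMap.det φ.toLinearMap = -1 ∧ ∀ q, φ q = a * star q * b)) := by
  obtain ⟨l, -, rfl⟩ := φ.reflections_generate_dim
  induction l with
  | nil => exact ⟨1, 1, norm_one, norm_one, .inl ⟨LinearMap.det_id, by simp⟩⟩
  | cons v l ih =>
    rw [List.map_cons, List.prod_cons]
    generalize (l.map fun v => (Submodule.span ℝ {v})ᗮ.reflection).prod = ψ at ih ⊢
    rcases eq_or_ne v 0 with rfl | hv
    · have h : (Submodule.span ℝ {(0 : Quaternion ℝ)})ᗮ.reflection = 1 :=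
        LinearIsometryEquiv.ext fun q => Submodule.reflection_mem_subspace_eq_self (by simp)
      rwa [h, one_mul]
    obtain ⟨u, hu, hspan⟩ : ∃ u : Quaternion ℝ, ‖u‖ = 1 ∧
        Submodule.span ℝ {v} = Submodule.span ℝ {u} :=
      ⟨‖v‖⁻¹ • v, norm_smul_inv_norm hv,
        (Submodule.span_singleton_smul_eq (IsUnit.mk0 _ (by simpa using hv)) v).symm⟩
    have hdet : LinearMap.det ((Submodule.span ℝ {v})ᗮ.reflection * ψ).toLinearMap =
        -LinearMap.det ψ.toLinearMap := by
      have h : ((Submodule.span ℝ {v})ᗮ.reflection * ψ).toLinearMap =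
        (Submodule.span ℝ {v})ᗮ.reflection.toLinearMap ∘ₗ ψ.toLinearMap := rfl
      rw [h, LinearMap.det_comp, Submodule.det_reflection, Submodule.orthogonal_orthogonal,
        finrank_span_singleton hv, pow_one, neg_one_mul]
    have happly (q : Quaternion ℝ) :
        ((Submodule.span ℝ {v})ᗮ.reflection * ψ) q = -(u * star (ψ q) * u) := by
      rw [← reflection_orthogonal_span_singleton_apply hu]
      simp only [hspan]
      rfl
    obtain ⟨a, b, ha, hb, h⟩ := ih
    refine ⟨-(u * star b), star a * u, by simp [hu, hb], by simp [hu, ha], ?_⟩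
    rcases h with ⟨hd, h⟩ | ⟨hd, h⟩
    · exact .inr ⟨by rw [hdet, hd], fun q => by rw [happly, h]; simp [mul_assoc]⟩
    · exact .inl ⟨by rw [hdet, hd, neg_neg], fun q => by rw [happly, h]; simp [mul_assoc]⟩

end Quaternion

/-- Every ℝ-linear isometry of the quaternions with determinant 1 has the form
`q ↦ a·q·b⁻¹` for unit quaternions `a`, `b`. -/
theorem stmt9 (f : Quaternion ℝ →ₗ[ℝ] Quaternion ℝ)
    (hisom : ∀ q : Quaternion ℝ, ‖f q‖ = ‖q‖) (hdet : LinearMap.det f = 1) :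
    ∃ a b : Quaternion ℝ, ‖a‖ = 1 ∧ ‖b‖ = 1 ∧
      ∀ q : Quaternion ℝ, f q = a * q * b⁻¹ := by
  let φ : Quaternion ℝ ≃ₗᵢ[ℝ] Quaternion ℝ :=
    LinearIsometry.toLinearIsometryEquiv ⟨f, hisom⟩ rfl
  have hφ : φ.toLinearMap = f := rfl
  obtain ⟨a, b, ha, hb, ⟨-, h⟩ | ⟨hd, -⟩⟩ := Quaternion.exists_linearIsometryEquiv_eq φ
  · exact ⟨a, b⁻¹, ha, by simp [hb], fun q => by rw [inv_inv]; exact h q⟩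
  · rw [hφ, hdet] at hd
    norm_num at hd
end

section
/- Let V be a nonzero finite-dimensional real inner product space and let G be a finite group of linear isometries of V acting freely on the unit sphere (i.e., if g ∈ G fixes some vector v with ‖v‖ = 1, then g = id). If G has even order, then G contains the antipodal map −id. -/
/-- A finite group of linear isometries of a nonzero finite-dimensional real
inner product space acting freely on the unit sphere contains the antipodal
map `-id` whenever it has even order. -/
theorem stmt11 (V : Type*) [NormedAddCommGroup V] [InnerProductSpace ℝ V]
    [Nontrivial V] [FiniteDimensional ℝ V]
    (G : Subgroup (V ≃ₗᵢ[ℝ] V)) [Finite G]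
    (hfree : ∀ g ∈ G, ∀ v : V, ‖v‖ = 1 → g v = v → g = 1)
    (heven : Even (Nat.card G)) :
    LinearIsometryEquiv.neg ℝ ∈ G := by
  obtain ⟨⟨g, hg⟩, hord⟩ := exists_prime_orderOf_dvd_card' (G := G) 2 heven.two_dvd
  rw [Subgroup.orderOf_mk] at hord
  have hg_ne : g ≠ 1 := by
    rintro rfl
    simp at hord
  have hsq (v : V) : g (g v) = v := by
    have h : g ^ 2 = 1 := hord ▸ pow_orderOf_eq_one g
    rw [sq] at h
    exact DFunLike.congr_fun h v
  have hneg : g = LinearIsometryEquiv.neg ℝ := by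
    ext v
    by_contra hv
    have hw : g v + v ≠ 0 := fun h => hv (eq_neg_of_add_eq_zero_left h)
    refine hg_ne (hfree g hg (‖g v + v‖⁻¹ • (g v + v)) ?_ ?_)
    · exact norm_smul_inv_norm (𝕜 := ℝ) hw
    · rw [map_smul, map_add, hsq, add_comm v]
  exact hneg ▸ hg
end

section
/- Let Γ be a finite subgroup of S³ × S³ (pairs of unit quaternions) containing (−1,−1), and suppose that every pair (a,b) ∈ Γ for which a is conjugate to b in S³ satisfies (a,b) ∈ {(1,1), (−1,−1)} (equivalently, the induced group of isometries q ↦ a·q·b⁻¹ of ℝ⁴ acts freely on the unit sphere S³). Then at least one of the two projections of Γ to the factors of S³ × S³ is a cyclic group. -/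
/-- The group `S³` of unit quaternions. -/
abbrev UnitQuaternions : Type := Metric.sphere (0 : Quaternion ℝ) 1

/-- `-1` as a unit quaternion. -/
noncomputable def negOneUQ : UnitQuaternions :=
  ⟨-1, by simp [mem_sphere_zero_iff_norm]⟩

open scoped IsMulCommutative in
/-- A finite commutative group that embeds in the multiplicative monoid of a (not necessarily
commutative) domain is cyclic. -/
theorem isCyclic_of_injective_of_commute {G R : Type*} [Group G] [Finite G] [Ring R] [IsDomain R]
    (f : G →* R) (hf : Function.Injective f) (hcomm : ∀ x y : G, Commute x y) : IsCyclic G := by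
  have hs : ∀ x ∈ Set.range f, ∀ y ∈ Set.range f, x * y = y * x := by
    rintro _ ⟨g, rfl⟩ _ ⟨h, rfl⟩
    exact ((hcomm g h).map f).eq
  have := Subring.isMulCommutative_closure hs
  let f' : G →* Subring.closure (Set.range f) :=
    { toFun g := ⟨f g, Subring.subset_closure ⟨g, rfl⟩⟩
      map_one' := Subtype.ext f.map_one
      map_mul' x y := Subtype.ext (f.map_mul x y) }
  have hf' : Function.Injective f' := fun x y h => hf (Subtype.ext_iff.1 h)
  exact isCyclic_of_injective_ringHom f' hf'

namespace UnitQuaternions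

open scoped Quaternion

theorem sq_sum (x : UnitQuaternions) :
    x.1.re ^ 2 + x.1.imI ^ 2 + x.1.imJ ^ 2 + x.1.imK ^ 2 = 1 := by
  have h : ‖x.1‖ = 1 := by simp
  rw [← Quaternion.normSq_def', Quaternion.normSq_eq_norm_mul_self, h, mul_one]

theorem coe_inv (x : UnitQuaternions) : (x⁻¹).1 = star x.1 := by
  have h : ‖x.1‖ = 1 := by simp
  have h1 : Quaternion.normSq x.1 = 1 := by
    rw [Quaternion.normSq_eq_norm_mul_self, h, mul_one]
  change (x.1)⁻¹ = _
  rw [Quaternion.inv_def, h1]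
  simp

theorem coe_mul (x y : UnitQuaternions) : (x * y).1 = x.1 * y.1 := rfl

theorem coe_negOneUQ : negOneUQ.1 = -1 := rfl

theorem re_conj (u a : UnitQuaternions) : (u * a * u⁻¹).1.re = a.1.re := by
  have := sq_sum u
  simp only [coe_mul, coe_inv, Quaternion.re_mul, Quaternion.imI_mul, Quaternion.imJ_mul,
    Quaternion.imK_mul, Quaternion.re_star, Quaternion.imI_star, Quaternion.imJ_star,
    Quaternion.imK_star]
  linear_combination a.1.re * this

theorem eq_one_or_of_im_eq_zero (z : UnitQuaternions) (h1 : z.1.imI = 0) (h2 : z.1.imJ = 0)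
    (h3 : z.1.imK = 0) : z = 1 ∨ z = negOneUQ := by
  have h := sq_sum z
  have : (z.1.re - 1) * (z.1.re + 1) = 0 := by rw [h1, h2, h3] at h; linear_combination h
  refine (mul_eq_zero.1 this).imp (fun h => ?_) (fun h => ?_)
  · exact Subtype.ext (Quaternion.ext _ _ (sub_eq_zero.1 h) h1 h2 h3)
  · refine Subtype.ext (Quaternion.ext _ _ ?_ ?_ ?_ ?_)
    · rw [coe_negOneUQ, Quaternion.re_neg, Quaternion.re_one]
      linarith
    all_goals simp [coe_negOneUQ, h1, h2, h3]

theorem commute_iff (x y : UnitQuaternions) : Commute x y ↔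
    x.1.imI * y.1.imJ = x.1.imJ * y.1.imI ∧ x.1.imJ * y.1.imK = x.1.imK * y.1.imJ ∧
      x.1.imI * y.1.imK = x.1.imK * y.1.imI := by
  rw [commute_iff_eq, Subtype.ext_iff, Quaternion.ext_iff]
  simp only [coe_mul, Quaternion.re_mul, Quaternion.imI_mul, Quaternion.imJ_mul,
    Quaternion.imK_mul]
  constructor
  · rintro ⟨-, h1, h2, h3⟩
    refine ⟨?_, ?_, ?_⟩ <;> linarith
  · rintro ⟨h1, h2, h3⟩
    refine ⟨?_, ?_, ?_, ?_⟩ <;> linarith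

theorem commute_of_commute {x y z : UnitQuaternions} (hz1 : z ≠ 1) (hz2 : z ≠ negOneUQ)
    (hx : Commute x z) (hy : Commute y z) : Commute x y := by
  rw [commute_iff] at *
  obtain ⟨a1, a2, a3⟩ := hx
  obtain ⟨b1, b2, b3⟩ := hy
  have : z.1.imI ≠ 0 ∨ z.1.imJ ≠ 0 ∨ z.1.imK ≠ 0 := by
    by_contra! h
    rcases eq_one_or_of_im_eq_zero z h.1 h.2.1 h.2.2 with h | h <;> contradiction
  rcases this with h | h | h
  · refine ⟨?_, ?_, ?_⟩ <;> apply mul_left_cancel₀ h <;> grind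
  · refine ⟨?_, ?_, ?_⟩ <;> apply mul_left_cancel₀ h <;> grind
  · refine ⟨?_, ?_, ?_⟩ <;> apply mul_left_cancel₀ h <;> grind

theorem re_eq_zero_of_conj_eq_inv {g z : UnitQuaternions} (hz1 : z ≠ 1) (hz2 : z ≠ negOneUQ)
    (h : g * z * g⁻¹ = z⁻¹) : g.1.re = 0 := by
  have h' : g * z = z⁻¹ * g := by rw [← h]; group
  rw [Subtype.ext_iff, Quaternion.ext_iff] at h'
  simp only [coe_mul, coe_inv, Quaternion.re_mul, Quaternion.imI_mul, Quaternion.imJ_mul,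
    Quaternion.imK_mul, Quaternion.re_star, Quaternion.imI_star, Quaternion.imJ_star,
    Quaternion.imK_star] at h'
  obtain ⟨-, h1, h2, h3⟩ := h'
  by_contra hg
  have e1 : z.1.imI = 0 := by apply mul_left_cancel₀ hg; linarith
  have e2 : z.1.imJ = 0 := by apply mul_left_cancel₀ hg; linarith
  have e3 : z.1.imK = 0 := by apply mul_left_cancel₀ hg; linarith
  rcases eq_one_or_of_im_eq_zero z e1 e2 e3 with h | h <;> contradiction

theorem eq_or_eq_inv_of_commute {w z : UnitQuaternions} (h : Commute w z)
    (hre : w.1.re = z.1.re) : w = z ∨ w = z⁻¹ := by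
  have hu := sq_sum w
  have hv := sq_sum z
  rw [commute_iff] at h
  obtain ⟨h1, h2, h3⟩ := h
  have key : (w.1 - z.1) * (w.1 - star z.1) = 0 := by
    refine Quaternion.ext _ _ ?_ ?_ ?_ ?_ <;> simp <;> grind
  refine (mul_eq_zero.1 key).imp (fun h => Subtype.ext (sub_eq_zero.1 h))
    (fun h => Subtype.ext ?_)
  rw [coe_inv]
  exact sub_eq_zero.1 h

theorem sq_eq_of_re_eq_zero {g : UnitQuaternions} (h : g.1.re = 0) : g ^ 2 = negOneUQ := by
  have := sq_sum g
  rw [h] at this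
  rw [sq]
  refine Subtype.ext (Quaternion.ext _ _ ?_ ?_ ?_ ?_) <;>
    simp only [coe_negOneUQ, coe_mul, Quaternion.re_mul, Quaternion.imI_mul, Quaternion.imJ_mul,
      Quaternion.imK_mul, Quaternion.re_neg, Quaternion.imI_neg, Quaternion.imJ_neg,
      Quaternion.imK_neg, Quaternion.re_one, Quaternion.imI_one, Quaternion.imJ_one,
      Quaternion.imK_one, h] <;> linarith

theorem exists_eq_conj_of_mul_eq {a b : UnitQuaternions} {c : Quaternion ℝ} (hc : c ≠ 0)
    (h : a.1 * c = c * b.1) : ∃ u : UnitQuaternions, a = u * b * u⁻¹ := by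
  refine ⟨⟨(‖c‖⁻¹ : ℝ) • c, ?_⟩, ?_⟩
  · simp [norm_smul, hc]
  · rw [eq_mul_inv_iff_mul_eq]
    apply Subtype.ext
    simp [h]

theorem exists_conj_of_re_eq_zero {a b : UnitQuaternions} (ha : a.1.re = 0) (hb : b.1.re = 0) :
    ∃ u : UnitQuaternions, a = u * b * u⁻¹ := by
  have ha' : a.1 * a.1 = -1 := by
    rw [← coe_mul, ← sq, sq_eq_of_re_eq_zero ha, coe_negOneUQ]
  have hb' : b.1 * b.1 = -1 := by
    rw [← coe_mul, ← sq, sq_eq_of_re_eq_zero hb, coe_negOneUQ]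
  by_contra! hne
  have key (c : Quaternion ℝ) : c = a.1 * c * b.1 := by
    by_contra hc
    obtain ⟨u, hu⟩ := exists_eq_conj_of_mul_eq (c := c - a.1 * c * b.1) (sub_ne_zero.2 hc)
      (a := a) (b := b) (by
        rw [mul_sub, sub_mul, mul_assoc _ b.1 b.1, hb', ← mul_assoc, ← mul_assoc, ha']
        noncomm_ring)
    exact hne u hu
  have comm (c : Quaternion ℝ) : a.1 * c = c * a.1 := by
    have h1 := key 1
    rw [mul_one] at h1
    have hba : b.1 * a.1 = 1 := mul_eq_one_comm.1 h1.symm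
    conv_rhs => rw [key c, mul_assoc, hba, mul_one]
  have hcomm (c : Quaternion ℝ) := Quaternion.ext_iff.1 (comm c)
  simp only [Quaternion.re_mul, Quaternion.imI_mul, Quaternion.imJ_mul, Quaternion.imK_mul]
    at hcomm
  have hi := hcomm ⟨0, 1, 0, 0⟩
  have hj := hcomm ⟨0, 0, 1, 0⟩
  have h := sq_sum a
  simp only [ha, mul_zero, mul_one, zero_mul, one_mul] at hi hj h
  grind

theorem negOneUQ_sq : negOneUQ ^ 2 = 1 :=
  Subtype.ext (by simp [sq, coe_negOneUQ])

theorem re_eq_zero_of_conj_eq_neg {g z : UnitQuaternions} (h : g * z * g⁻¹ = negOneUQ * z) :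
    z.1.re = 0 := by
  have := re_conj g z
  rw [h, coe_mul, coe_negOneUQ, neg_one_mul, Quaternion.re_neg] at this
  linarith

variable {G : Type*} [Group G] {φ : G →* UnitQuaternions}

theorem isCyclic_of_commute [Finite G] (hφ : Function.Injective φ)
    (hcomm : ∀ x y : G, Commute x y) : IsCyclic G :=
  isCyclic_of_injective_of_commute ((Submonoid.unitSphere (Quaternion ℝ)).subtype.comp φ)
    (Subtype.val_injective.comp hφ) hcomm

theorem negOneUQ_pow_ne_one {n : ℕ} (hn : Odd n) : negOneUQ ^ n ≠ 1 := by
  intro h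
  have h' : (-1 : Quaternion ℝ) ^ n = 1 := congrArg Subtype.val h
  rw [hn.neg_one_pow] at h'
  have := congrArg (fun q : Quaternion ℝ => q.re) h'
  simp at this
  norm_num at this

theorem isCyclic_of_isPGroup_odd [Finite G] (hφ : Function.Injective φ) {p : ℕ} [Fact p.Prime]
    (hp : Odd p) (hG : IsPGroup p G) : IsCyclic G := by
  rcases subsingleton_or_nontrivial G with _ | _
  · infer_instance
  have := hG.center_nontrivial
  obtain ⟨⟨z, hz⟩, hz1⟩ := exists_ne (1 : Subgroup.center G)
  have hz1 : z ≠ 1 := fun h => hz1 (Subtype.ext h)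
  have h1 : φ z ≠ 1 := fun h => hz1 (hφ (h.trans φ.map_one.symm))
  have h2 : φ z ≠ negOneUQ := by
    intro h
    obtain ⟨k, hk⟩ := hG z
    apply negOneUQ_pow_ne_one (hp.pow (n := k))
    rw [← h, ← map_pow, hk, map_one]
  have hc (x : G) : Commute x z := (Subgroup.mem_center_iff.1 hz x)
  exact isCyclic_of_commute hφ fun x y => Commute.of_map hφ
    (commute_of_commute h1 h2 ((hc x).map φ) ((hc y).map φ))

theorem exists_subgroup_of_isPGroup_two [Finite G] (hφ : Function.Injective φ)
    (hG : IsPGroup 2 G) (hnc : ¬ IsCyclic G) :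
    ∃ C : Subgroup G, C ≠ ⊤ ∧ ∀ g ∉ C, (φ g).1.re = 0 := by
  have hcen (z : G) (hz : z ∈ Subgroup.center G) : φ z = 1 ∨ φ z = negOneUQ := by
    by_contra! h
    have hc (x : G) : Commute x z := Subgroup.mem_center_iff.1 hz x
    exact hnc (isCyclic_of_commute hφ fun x y => Commute.of_map hφ
      (commute_of_commute h.1 h.2 ((hc x).map φ) ((hc y).map φ)))
  have hnt : Nontrivial (G ⧸ Subgroup.center G) := by
    rw [QuotientGroup.nontrivial_iff]
    intro h
    refine hnc (isCyclic_of_commute hφ fun x y => ?_)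
    exact Subgroup.mem_center_iff.1 (h ▸ Subgroup.mem_top y) x
  have := (hG.to_quotient (Subgroup.center G)).center_nontrivial
  obtain ⟨⟨q, hq⟩, hq1⟩ := exists_ne (1 : Subgroup.center (G ⧸ Subgroup.center G))
  obtain ⟨z, rfl⟩ := QuotientGroup.mk_surjective q
  have hz : z ∉ Subgroup.center G := fun h =>
    hq1 (Subtype.ext ((QuotientGroup.eq_one_iff z).2 h))
  have hz1 : φ z ≠ 1 := fun h => hz (by
    rw [hφ (h.trans φ.map_one.symm)]; exact one_mem _)
  have hz2 : φ z ≠ negOneUQ := fun h => hz (by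
    refine Subgroup.mem_center_iff.2 fun g => hφ ?_
    rw [map_mul, map_mul, h]
    exact Subtype.ext (by simp [coe_negOneUQ]))
  refine ⟨Subgroup.centralizer {z}, fun h => hz ?_, fun g hg => ?_⟩
  · refine Subgroup.mem_center_iff.2 fun g => ?_
    exact (Subgroup.mem_centralizer_singleton_iff.1 (h ▸ Subgroup.mem_top g))
  have hmem : g * z * g⁻¹ * z⁻¹ ∈ Subgroup.center G := by
    rw [← QuotientGroup.eq_one_iff]
    have := Subgroup.mem_center_iff.1 hq (g : G ⧸ Subgroup.center G)
    simp only [QuotientGroup.mk_mul, QuotientGroup.mk_inv]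
    rw [this]; group
  have hne : φ (g * z * g⁻¹ * z⁻¹) ≠ 1 := by
    intro h
    apply hg
    rw [Subgroup.mem_centralizer_singleton_iff]
    have := hφ (h.trans φ.map_one.symm)
    rw [mul_inv_eq_one, mul_inv_eq_iff_eq_mul] at this
    exact this
  have hconj : φ g * φ z * (φ g)⁻¹ = negOneUQ * φ z := by
    have := (hcen _ hmem).resolve_left hne
    rw [← this]
    simp
  have hre : (φ z).1.re = 0 := re_eq_zero_of_conj_eq_neg hconj
  refine re_eq_zero_of_conj_eq_inv hz1 hz2 (hconj.trans ?_)
  rw [eq_inv_iff_mul_eq_one, mul_assoc, ← sq, sq_eq_of_re_eq_zero hre, ← sq, negOneUQ_sq]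

theorem exists_subgroup_of_isZGroup [Finite G] [IsZGroup G] (hφ : Function.Injective φ)
    (hnc : ¬ IsCyclic G) (P : Sylow 2 G) :
    ∃ C : Subgroup G, ¬ P ≤ C ∧ ∀ g ∉ C, (φ g).1.re = 0 := by
  obtain ⟨⟨z, hzG⟩, hgen⟩ := IsZGroup.isCyclic_commutator (G := G)
  have hpow (g : G) (hg : g ∈ commutator G) : ∃ n : ℤ, z ^ n = g := by
    obtain ⟨n, hn⟩ := hgen ⟨g, hg⟩
    exact ⟨n, congrArg Subtype.val hn⟩
  obtain ⟨x, y, hxy⟩ : ∃ x y : G, ¬ Commute x y := by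
    by_contra! h
    exact hnc (isCyclic_of_commute hφ h)
  have hmem : x * y * x⁻¹ * y⁻¹ ∈ commutator G :=
    Subgroup.commutator_mem_commutator (Subgroup.mem_top x) (Subgroup.mem_top y)
  have hne : x * y * x⁻¹ * y⁻¹ ≠ 1 := by
    rwa [Ne, mul_inv_eq_one, mul_inv_eq_iff_eq_mul]
  have hz1 : φ z ≠ 1 := by
    intro h
    obtain ⟨n, hn⟩ := hpow _ hmem
    rw [hφ (h.trans φ.map_one.symm), one_zpow] at hn
    exact hne hn.symm
  have hz2 : φ z ≠ negOneUQ := by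
    intro hz
    have hz_sq : z ^ 2 = 1 := hφ (by rw [map_pow, hz, negOneUQ_sq, map_one])
    have hz_ne : z ≠ 1 := fun h => hz1 (by rw [h, map_one])
    have hcases (g : G) (hg : g ∈ commutator G) : g = 1 ∨ g = z := by
      obtain ⟨n, rfl⟩ := hpow g hg
      obtain ⟨k, rfl | rfl⟩ := n.even_or_odd'
      · left
        rw [zpow_mul, zpow_ofNat, hz_sq, one_zpow]
      · right
        rw [zpow_add, zpow_mul, zpow_ofNat, hz_sq, one_zpow, one_mul, zpow_one]
    have hconj : φ x * φ y * (φ x)⁻¹ = negOneUQ * φ y := by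
      rw [← hz, ← (hcases _ hmem).resolve_left hne]
      simp
    have hre := re_eq_zero_of_conj_eq_neg hconj
    have hy_sq : y ^ 2 = z := hφ (by rw [map_pow, sq_eq_of_re_eq_zero hre, hz])
    have hy : y ∉ commutator G := by
      intro h
      rcases hcases y h with rfl | rfl
      · exact hxy (Commute.one_right x)
      · exact hz_ne (hy_sq.symm.trans hz_sq)
    have h1 : 2 ∣ Nat.card (commutator G) := by
      have : orderOf (⟨z, hzG⟩ : commutator G) = 2 :=
        orderOf_eq_prime (Subtype.ext hz_sq) fun h => hz_ne (congrArg Subtype.val h)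
      exact this ▸ orderOf_dvd_natCard _
    have h2 : 2 ∣ (commutator G).index := by
      have : orderOf (y : G ⧸ commutator G) = 2 := by
        refine orderOf_eq_prime ?_ fun h => hy ((QuotientGroup.eq_one_iff y).1 h)
        rw [← QuotientGroup.mk_pow, QuotientGroup.eq_one_iff, hy_sq]
        exact hzG
      exact this ▸ orderOf_dvd_natCard _
    exact Nat.not_coprime_of_dvd_of_dvd one_lt_two h1 h2 (IsZGroup.coprime_commutator_index G)
  have hconj (g : G) : g * z * g⁻¹ = z ∨ g * z * g⁻¹ = z⁻¹ := by
    obtain ⟨n, hn⟩ := hpow _ (Subgroup.Normal.conj_mem inferInstance z hzG g)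
    have hcomm : Commute (φ (g * z * g⁻¹)) (φ z) := by
      rw [← hn]
      exact ((Commute.refl z).zpow_left n).map φ
    refine (eq_or_eq_inv_of_commute hcomm ?_).imp (fun h => hφ h) fun h => hφ ?_
    · rw [map_mul, map_mul, map_inv, re_conj]
    · rw [h, map_inv]
  have hre (g : G) (hg : ¬ Commute g z) : (φ g).1.re = 0 := by
    refine re_eq_zero_of_conj_eq_inv hz1 hz2 ?_
    rw [← map_inv, ← map_inv, ← map_mul, ← map_mul]
    exact congrArg φ ((hconj g).resolve_left fun h => hg (mul_inv_eq_iff_eq_mul.1 h))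
  refine ⟨Subgroup.centralizer {z}, fun hP => ?_, fun g hg =>
    hre g fun h => hg (Subgroup.mem_centralizer_singleton_iff.2 h)⟩
  obtain ⟨g, hg⟩ : ∃ g, ¬ Commute g z := by
    by_contra! hc
    exact hnc (isCyclic_of_commute hφ fun x y => Commute.of_map hφ
      (commute_of_commute hz1 hz2 ((hc x).map φ) ((hc y).map φ)))
  have hg4 : g ^ 2 ^ 2 = 1 := hφ (by
    rw [sq 2, pow_mul, map_pow, map_pow, sq_eq_of_re_eq_zero (hre g hg), map_one, negOneUQ_sq])
  have hpg : IsPGroup 2 (Subgroup.zpowers g) := by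
    have : orderOf g ∣ 2 ^ 2 := orderOf_dvd_of_pow_eq_one hg4
    obtain ⟨k, -, hk⟩ := (Nat.dvd_prime_pow Nat.prime_two).1 this
    exact IsPGroup.of_card (n := k) (by rw [Nat.card_zpowers, hk])
  obtain ⟨Q, hQ⟩ := hpg.exists_le_sylow
  obtain ⟨h, rfl⟩ := MulAction.exists_smul_eq G P Q
  obtain ⟨p, hp, hpg⟩ := hQ (Subgroup.mem_zpowers g)
  have hpg : h * p * h⁻¹ = g := hpg
  have hpz : Commute p z := Subgroup.mem_centralizer_singleton_iff.1 (hP hp)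
  have hpc : Commute p (h⁻¹ * z * h) := by
    have := hconj h⁻¹
    rw [inv_inv] at this
    rcases this with e | e <;> rw [e]
    exacts [hpz, hpz.inv_right]
  apply hg
  have : Commute (h * p * h⁻¹) (h * (h⁻¹ * z * h) * h⁻¹) := (Commute.conj_iff h).2 hpc
  rw [hpg] at this
  convert this using 1
  group

theorem exists_subgroup_of_not_isCyclic [Finite G] (hφ : Function.Injective φ)
    (hnc : ¬ IsCyclic G) (P : Sylow 2 G) :
    ∃ C : Subgroup G, ¬ P ≤ C ∧ ∀ g ∈ P, g ∉ C → (φ g).1.re = 0 := by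
  by_cases hP : IsCyclic P
  · have : IsZGroup G := by
      refine ⟨fun p hp Q => ?_⟩
      have := Fact.mk hp
      rcases hp.eq_two_or_odd' with rfl | hodd
      · exact (P.equiv Q).isCyclic.1 hP
      · exact isCyclic_of_isPGroup_odd (φ := φ.comp (Q : Subgroup G).subtype)
          (hφ.comp Subtype.val_injective) hodd Q.isPGroup'
    obtain ⟨C, hC, h⟩ := exists_subgroup_of_isZGroup hφ hnc P
    exact ⟨C, hC, fun g _ => h g⟩
  · obtain ⟨C, hC, h⟩ := exists_subgroup_of_isPGroup_two
      (φ := φ.comp (P : Subgroup G).subtype) (hφ.comp Subtype.val_injective) P.isPGroup' hP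
    refine ⟨C.map (P : Subgroup G).subtype, fun hle => hC ?_, fun g hg hgC => ?_⟩
    · refine (Subgroup.eq_top_iff' C).2 fun g => ?_
      obtain ⟨g', hg', e⟩ := hle g.2
      rwa [← Subtype.ext e]
    · exact h ⟨g, hg⟩ fun hmem => hgC ⟨⟨g, hg⟩, hmem, rfl⟩

theorem exists_subgroup_of_not_isCyclic_range [Finite G] (φ : G →* UnitQuaternions)
    (hnc : ¬ IsCyclic φ.range) (P : Sylow 2 G) :
    ∃ C : Subgroup G, ¬ P ≤ C ∧ ∀ g ∈ P, g ∉ C → (φ g).1.re = 0 := by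
  have : Finite φ.range := Finite.of_surjective _ φ.rangeRestrict_surjective
  obtain ⟨C, hC, h⟩ := exists_subgroup_of_not_isCyclic (φ := φ.range.subtype)
    Subtype.val_injective hnc (P.mapSurjective φ.rangeRestrict_surjective)
  refine ⟨C.comap φ.rangeRestrict, fun hle => hC ?_, fun g hg hgC => ?_⟩
  · rw [Sylow.coe_mapSurjective]
    exact Subgroup.map_le_iff_le_comap.2 hle
  · exact h (φ.rangeRestrict g) ⟨g, hg, rfl⟩ hgC

end UnitQuaternions

theorem Subgroup.exists_mem_notMem_notMem {G : Type*} [Group G] {P C D : Subgroup G}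
    (hC : ¬ P ≤ C) (hD : ¬ P ≤ D) : ∃ g ∈ P, g ∉ C ∧ g ∉ D := by
  obtain ⟨x, hxP, hxC⟩ := SetLike.not_le_iff_exists.1 hC
  obtain ⟨y, hyP, hyD⟩ := SetLike.not_le_iff_exists.1 hD
  by_cases hxD : x ∈ D
  · by_cases hyC : y ∈ C
    · exact ⟨x * y, P.mul_mem hxP hyP, fun h => hxC ((C.mul_mem_cancel_right hyC).1 h),
        fun h => hyD ((D.mul_mem_cancel_left hxD).1 h)⟩
    · exact ⟨y, hyP, hyC, hyD⟩
  · exact ⟨x, hxP, hxC, hxD⟩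

/-- Let `Γ ≤ S³ × S³` be a finite subgroup containing `(-1,-1)` such that every
`(a,b) ∈ Γ` with `a` conjugate to `b` in `S³` lies in `{(1,1), (-1,-1)}` (i.e.
the induced group of isometries of `ℝ⁴` acts freely on `S³`).  Then at least
one of the two projections of `Γ` is cyclic. -/
theorem stmt12 (Γ : Subgroup (UnitQuaternions × UnitQuaternions)) [Finite Γ]
    (hneg : (negOneUQ, negOneUQ) ∈ Γ)
    (hfree : ∀ p ∈ Γ, (∃ u : UnitQuaternions, p.1 = u * p.2 * u⁻¹) →
      p = 1 ∨ p = (negOneUQ, negOneUQ)) :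
    IsCyclic (Γ.map (MonoidHom.fst UnitQuaternions UnitQuaternions)) ∨
    IsCyclic (Γ.map (MonoidHom.snd UnitQuaternions UnitQuaternions)) := by
  by_contra! h
  obtain ⟨h1, h2⟩ := h
  rw [← Γ.range_subtype, ← MonoidHom.range_comp] at h1 h2
  obtain ⟨P⟩ : Nonempty (Sylow 2 Γ) := inferInstance
  obtain ⟨C, hC, hCre⟩ := UnitQuaternions.exists_subgroup_of_not_isCyclic_range _ h1 P
  obtain ⟨D, hD, hDre⟩ := UnitQuaternions.exists_subgroup_of_not_isCyclic_range _ h2 P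
  obtain ⟨g, hgP, hgC, hgD⟩ := Subgroup.exists_mem_notMem_notMem hC hD
  have hre : g.1.1.1.re = 0 := hCre g hgP hgC
  rcases hfree g.1 g.2 (UnitQuaternions.exists_conj_of_re_eq_zero hre (hDre g hgP hgD))
    with e | e
  · rw [e] at hre
    exact one_ne_zero hre
  · rw [e] at hre
    exact neg_ne_zero.2 one_ne_zero hre
end
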